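/- Let G be a finite group and H₁, H₂ ≤ G satisfying the Sunada condition. Then the complex permutation modules ℂ[G/H₁] and ℂ[G/H₂] are isomorphic as G-representations. -/

import Mathlib

section FinrankLinearMap

open Module

variable {k A : Type*} [Field k] [Ring A] [Algebra k A]

theorem Module.Finite.linearMap_of_isScalarTower {U M : Type*}
    [AddCommGroup U] [Module k U] [Module A U] [IsScalarTower k A U] [Module.Finite k U]
    [AddCommGroup M] [Module k M] [Module A M] [IsScalarTower k A M] [Module.Finite k M] :
    Module.Finite k (U →ₗ[A] M) :=
  Module.Finite.of_injective (LinearMap.restrictScalarsₗ k A U M k)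
    (LinearMap.restrictScalars_injective k)

theorem LinearEquiv.finrank_linearMap_eq {U U' M N : Type*}
    [AddCommGroup U] [Module A U] [AddCommGroup U'] [Module A U']
    [AddCommGroup M] [Module k M] [Module A M] [IsScalarTower k A M]
    [AddCommGroup N] [Module k N] [Module A N] [IsScalarTower k A N]
    (e : U ≃ₗ[A] U') (f : M ≃ₗ[A] N) : finrank k (U →ₗ[A] M) = finrank k (U' →ₗ[A] N) :=
  LinearEquiv.finrank_eq
    { e.arrowCongrAddEquiv f with
      map_smul' := fun c g => by
        ext x
        exact (f.restrictScalars k).map_smul c (g (e.symm x)) }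

theorem finrank_linearMap_prod {U M N : Type*}
    [AddCommGroup U] [Module k U] [Module A U] [IsScalarTower k A U] [Module.Finite k U]
    [AddCommGroup M] [Module k M] [Module A M] [IsScalarTower k A M] [Module.Finite k M]
    [AddCommGroup N] [Module k N] [Module A N] [IsScalarTower k A N] [Module.Finite k N] :
    finrank k (U →ₗ[A] M × N) = finrank k (U →ₗ[A] M) + finrank k (U →ₗ[A] N) := by
  have := Module.Finite.linearMap_of_isScalarTower (k := k) (A := A) (U := U) (M := M)
  have := Module.Finite.linearMap_of_isScalarTower (k := k) (A := A) (U := U) (M := N)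
  rw [← (LinearMap.prodEquiv (R := A) (M := U) (M₂ := M) (M₃ := N) k).finrank_eq,
    finrank_prod]

/-- A finite-dimensional module over a semisimple algebra is determined up to isomorphism by the
dimensions of its spaces of homomorphisms from finite-dimensional modules. -/
theorem IsSemisimpleRing.nonempty_linearEquiv_of_finrank_linearMap_eq.{u} [IsSemisimpleRing A]
    (M N : Type u)
    [AddCommGroup M] [Module k M] [Module A M] [IsScalarTower k A M] [Module.Finite k M]
    [AddCommGroup N] [Module k N] [Module A N] [IsScalarTower k A N] [Module.Finite k N]
    (h : ∀ (U : Type u) [AddCommGroup U] [Module k U] [Module A U] [IsScalarTower k A U]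
      [Module.Finite k U], finrank k (U →ₗ[A] M) = finrank k (U →ₗ[A] N)) :
    Nonempty (M ≃ₗ[A] N) := by
  induction hn : finrank k M using Nat.strong_induction_on generalizing M N with
  | _ n ih =>
  rcases subsingleton_or_nontrivial M with hM | hM
  · have := Module.Finite.linearMap_of_isScalarTower (k := k) (A := A) (U := N) (M := N)
    have hN := h N
    rw [finrank_zero_of_subsingleton, eq_comm, finrank_zero_iff] at hN
    have : Subsingleton N := subsingleton_of_forall_eq 0 fun x =>
      LinearMap.congr_fun (Subsingleton.elim (LinearMap.id : N →ₗ[A] N) 0) x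
    exact ⟨0⟩
  · obtain ⟨S, hS⟩ := IsSemisimpleModule.exists_simple_submodule A M
    have : Module.Finite k S := inferInstanceAs (Module.Finite k (S.restrictScalars k))
    have := Module.Finite.linearMap_of_isScalarTower (k := k) (A := A) (U := S) (M := M)
    have hSM : 0 < finrank k (S →ₗ[A] M) := by
      have := IsSimpleModule.nontrivial A S
      refine finrank_pos_iff_exists_ne_zero.2 ⟨S.subtype, fun h0 => ?_⟩
      obtain ⟨x, hx⟩ := exists_ne (0 : S)
      exact hx (Subtype.ext (LinearMap.congr_fun h0 x))
    rw [h S] at hSM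
    have := Module.nontrivial_of_finrank_pos hSM
    obtain ⟨f, hf⟩ := exists_ne (0 : S →ₗ[A] N)
    have hfi := LinearMap.injective_of_ne_zero hf
    obtain ⟨S', hS'⟩ := exists_isCompl S
    obtain ⟨T', hT'⟩ := exists_isCompl (LinearMap.range f)
    have : Module.Finite k S' := inferInstanceAs (Module.Finite k (S'.restrictScalars k))
    have : Module.Finite k T' := inferInstanceAs (Module.Finite k (T'.restrictScalars k))
    let eM : (S × S') ≃ₗ[A] M := S.prodEquivOfIsCompl S' hS'
    let eN : (S × T') ≃ₗ[A] N := ((LinearEquiv.ofInjective f hfi).prodCongr (.refl A T')).trans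
      ((LinearMap.range f).prodEquivOfIsCompl T' hT')
    have hlt : finrank k S' < n := by
      have := IsSimpleModule.nontrivial A S
      rw [← hn, ← (eM.restrictScalars k).finrank_eq, finrank_prod]
      have : 0 < finrank k S := finrank_pos
      lia
    obtain ⟨e⟩ := ih _ hlt S' T' (fun U _ _ _ _ _ => by
      have := h U
      rw [← (LinearEquiv.refl A U).finrank_linearMap_eq eM,
        ← (LinearEquiv.refl A U).finrank_linearMap_eq eN, finrank_linearMap_prod,
        finrank_linearMap_prod] at this
      exact Nat.add_left_cancel this) rfl
    exact ⟨eM.symm.trans (((LinearEquiv.refl A S).prodCongr e).trans eN)⟩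

end FinrankLinearMap

namespace Representation

open scoped MonoidAlgebra

/-- Over a field of characteristic zero, finite-dimensional representations of a finite group with
equal characters are isomorphic. -/
theorem nonempty_equiv_of_character_eq.{u} {k G : Type*} [Field k] [CharZero k] [Group G]
    [Finite G] {V W : Type u}
    [AddCommGroup V] [Module k V] [FiniteDimensional k V]
    [AddCommGroup W] [Module k W] [FiniteDimensional k W]
    (ρ : Representation k G V) (σ : Representation k G W) (h : ρ.character = σ.character) :
    Nonempty (ρ.Equiv σ) := by
  have := Fintype.ofFinite G
  have hG : (Nat.card G : k) ≠ 0 := Nat.cast_ne_zero.2 Nat.card_pos.ne'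
  have : NeZero (Nat.card G : k) := ⟨hG⟩
  let := invertibleOfNonzero hG
  obtain ⟨e⟩ := IsSemisimpleRing.nonempty_linearEquiv_of_finrank_linearMap_eq (k := k)
    (A := k[G]) ρ.asModule σ.asModule (fun U _ _ _ _ _ => by
      let τ : Representation k G U := ofModule' U
      let e : τ.asModule ≃ₗ[k[G]] U :=
        { τ.asModuleEquiv.toAddEquiv with
          map_smul' := fun a x => by
            have hτ : τ.asAlgebraHom = Algebra.lsmul k k U :=
              (MonoidAlgebra.lift k (U →ₗ[k] U) G).apply_symm_apply _
            change τ.asModuleEquiv (a • x) = a • τ.asModuleEquiv x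
            rw [asModuleEquiv_map_smul, hτ]
            rfl }
      rw [← e.finrank_linearMap_eq (.refl _ _), ← e.finrank_linearMap_eq (.refl _ _),
        ← (IntertwiningMap.equivLinearMapAsModule τ ρ).finrank_eq,
        ← (IntertwiningMap.equivLinearMapAsModule τ σ).finrank_eq]
      have h1 := card_inv_mul_sum_char_mul_char_eq_finrank τ ρ
      rw [h, card_inv_mul_sum_char_mul_char_eq_finrank] at h1
      exact_mod_cast h1.symm)
  refine ⟨.mk (ρ.asModuleEquiv.symm.trans ((e.restrictScalars k).trans σ.asModuleEquiv))
    fun g => ?_⟩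
  ext v
  change σ.asModuleEquiv (e (ρ.asModuleEquiv.symm (ρ g v))) =
    σ g (σ.asModuleEquiv (e (ρ.asModuleEquiv.symm v)))
  rw [asModuleEquiv_symm_map_rho, map_smul, asModuleEquiv_map_smul, asAlgebraHom_of]

/-- The representation of `G` on functions `X → k` by `(g • f) x = f (g⁻¹ • x)`. -/
def permutationFun (k G X : Type*) [CommSemiring k] [Group G] [MulAction G X] :
    Representation k G (X → k) where
  toFun g := LinearMap.funLeft k k (g⁻¹ • ·)
  map_one' := by ext; simp [LinearMap.funLeft]
  map_mul' g h := by ext; simp [LinearMap.funLeft, mul_smul]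

theorem character_permutationFun (k : Type*) {G X : Type*} [Field k] [Group G] [MulAction G X]
    [Finite X] (g : G) :
    (permutationFun k G X).character g = Nat.card (MulAction.fixedBy X g) := by
  classical
  have := Fintype.ofFinite X
  rw [character, LinearMap.trace_eq_matrix_trace k (Pi.basisFun k X), Matrix.trace,
    Nat.card_eq_fintype_card, Fintype.card_subtype, Finset.natCast_card_filter]
  refine Finset.sum_congr rfl fun x _ => ?_
  have hx : x = g⁻¹ • x ↔ g • x = x := by rw [eq_inv_smul_iff]
  simp [permutationFun, LinearMap.funLeft_apply, Pi.single_apply, eq_comm (b := x), hx]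

end Representation

theorem MulAction.card_setOf_smul_mem {G X : Type*} [Group G] [MulAction G X] (b : X)
    (S : Set X) :
    Nat.card {x : G | x • b ∈ S} =
      Nat.card (stabilizer G b) * Nat.card (orbit G b ∩ S : Set X) := by
  let e := orbitEquivQuotientStabilizer G b
  have hpre : {x : G | x • b ∈ S} =
      QuotientGroup.mk ⁻¹' {q : G ⧸ stabilizer G b | (e.symm q : X) ∈ S} := by
    ext x
    simp [e]
  have hS : Nat.card {q : G ⧸ stabilizer G b | (e.symm q : X) ∈ S} =
      Nat.card (orbit G b ∩ S : Set X) :=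
    Nat.card_congr ((e.symm.subtypeEquiv fun _ => Iff.rfl).trans
      (Equiv.subtypeSubtypeEquivSubtypeInter _ (· ∈ S)))
  rw [hpre, Nat.card_congr (QuotientGroup.preimageMkEquivSubgroupProdSet _ _), Nat.card_prod, hS]

theorem Subgroup.card_mul_card_fixedBy_quotient {G : Type*} [Group G] (H : Subgroup G) (g : G) :
    Nat.card H * Nat.card (MulAction.fixedBy (G ⧸ H) g) =
      Nat.card (MulAction.stabilizer (ConjAct G) g) *
        Nat.card ({x | IsConj g x} ∩ (H : Set G) : Set G) := by
  have h₁ := MulAction.card_setOf_smul_mem (G := G) ((1 : G) : G ⧸ H) (MulAction.fixedBy (G ⧸ H) g)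
  have h₂ := MulAction.card_setOf_smul_mem (G := ConjAct G) g (H : Set G)
  have horb : MulAction.orbit (ConjAct G) g = {x | IsConj g x} := by
    ext x
    rw [ConjAct.mem_orbit_conjAct, isConj_comm, Set.mem_ofPred_eq]
  rw [MulAction.stabilizer_quotient, MulAction.orbit_eq_univ, Set.univ_inter] at h₁
  rw [horb] at h₂
  rw [← h₁, ← h₂]
  refine Nat.card_congr (((Equiv.inv G).trans ConjAct.toConjAct.toEquiv).subtypeEquiv fun x => ?_)
  change g • x • ((1 : G) : G ⧸ H) = x • ((1 : G) : G ⧸ H) ↔ ConjAct.toConjAct x⁻¹ • g ∈ H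
  rw [ConjAct.toConjAct_smul, eq_comm, MulAction.Quotient.smul_mk, MulAction.Quotient.smul_mk,
    QuotientGroup.eq]
  simp [mul_assoc]

theorem Subgroup.card_eq_of_card_isConj_inter_eq {G : Type*} [Group G] [Finite G]
    {H₁ H₂ : Subgroup G}
    (h : ∀ g : G, Nat.card ({x | IsConj g x} ∩ (H₁ : Set G) : Set G) =
      Nat.card ({x | IsConj g x} ∩ (H₂ : Set G) : Set G)) :
    Nat.card H₁ = Nat.card H₂ := by
  have hfib (H : Subgroup G) (g : G) :
      Nat.card {x : H // ConjClasses.mk (x : G) = ConjClasses.mk g} =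
        Nat.card ({x | IsConj g x} ∩ (H : Set G) : Set G) := by
    refine Nat.card_congr ((Equiv.subtypeSubtypeEquivSubtypeInter (· ∈ H)
      (fun x => ConjClasses.mk x = ConjClasses.mk g)).trans (Equiv.subtypeEquivRight fun x => ?_))
    rw [ConjClasses.mk_eq_mk_iff_isConj, isConj_comm, and_comm]
    rfl
  have := Fintype.ofFinite (ConjClasses G)
  rw [← Nat.card_congr (Equiv.sigmaFiberEquiv fun x : H₁ => ConjClasses.mk (x : G)),
    ← Nat.card_congr (Equiv.sigmaFiberEquiv fun x : H₂ => ConjClasses.mk (x : G)),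
    Nat.card_sigma, Nat.card_sigma]
  refine Finset.sum_congr rfl fun c _ => ?_
  obtain ⟨g, rfl⟩ := ConjClasses.mk_surjective c
  rw [hfib, hfib, h]

/-- If `(G, H₁, H₂)` satisfies the Sunada condition, then the complex
permutation modules `ℂ[G/H₁]` and `ℂ[G/H₂]` (realized as the function spaces
`G⧸Hᵢ → ℂ` with the left translation action `(g • f) x = f (g⁻¹ • x)`) are isomorphic
as `G`-representations: there is a `ℂ`-linear isomorphism intertwining the actions. -/
theorem sunada_condition_permutation_modules_iso
    (G : Type*) [Group G] [Finite G] (H₁ H₂ : Subgroup G)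
    (hSunada : ∀ g : G,
      Nat.card ({x | IsConj g x} ∩ (H₁ : Set G) : Set G) =
        Nat.card ({x | IsConj g x} ∩ (H₂ : Set G) : Set G)) :
    ∃ T : ((G ⧸ H₁) → ℂ) ≃ₗ[ℂ] ((G ⧸ H₂) → ℂ),
      ∀ (g : G) (f : (G ⧸ H₁) → ℂ),
        T (fun x => f (g⁻¹ • x)) = fun x => T f (g⁻¹ • x) := by
  have hchar : (Representation.permutationFun ℂ G (G ⧸ H₁)).character =
      (Representation.permutationFun ℂ G (G ⧸ H₂)).character := by
    ext g
    rw [Representation.character_permutationFun, Representation.character_permutationFun]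
    have h₁ := H₁.card_mul_card_fixedBy_quotient g
    rw [hSunada g, ← H₂.card_mul_card_fixedBy_quotient g,
      Subgroup.card_eq_of_card_isConj_inter_eq hSunada] at h₁
    exact congrArg Nat.cast (Nat.eq_of_mul_eq_mul_left Nat.card_pos h₁)
  obtain ⟨φ⟩ := Representation.nonempty_equiv_of_character_eq _ _ hchar
  exact ⟨φ.toLinearEquiv, fun g f => φ.toIntertwiningMap.isIntertwining _ _ g f⟩
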